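/- Let J be an abelian complex structure on an (s+1)-step nilpotent Lie algebra g, so g^{s+1} = 0 and g^s ≠ 0. Then g_J^s = g^s + J g^s is contained in the center of g. -/

import Mathlib

/-- The `k`-th term `g^k` of the descending central series of `g`:
`g^0 = g`, `g^{k+1} = [g^k, g]`. -/
def dcs (g : Type*) [LieRing g] [LieAlgebra ℝ g] (k : ℕ) : Submodule ℝ g :=
  (LieModule.lowerCentralSeries ℝ g g k).toSubmodule

/-- `g_J^k = g^k + J g^k`. -/
def gJ (g : Type*) [LieRing g] [LieAlgebra ℝ g] (J : g →ₗ[ℝ] g) (k : ℕ) : Submodule ℝ g :=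
  dcs g k ⊔ (dcs g k).map J

/-- For an abelian complex structure `J` on an `(s+1)`-step nilpotent Lie
algebra `g` (so `g^{s+1} = 0` and `g^s ≠ 0`), the subspace `g_J^s = g^s + J g^s` is
contained in the center of `g`. -/
theorem gJs_le_center (g : Type*) [LieRing g] [LieAlgebra ℝ g] [FiniteDimensional ℝ g]
    (J : g →ₗ[ℝ] g) (hJ2 : ∀ X : g, J (J X) = -X)
    (habelian : ∀ A B : g, ⁅J A, J B⁆ = ⁅A, B⁆)
    (s : ℕ) (hstep : dcs g (s + 1) = ⊥) (hs : dcs g s ≠ ⊥) :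
    ∀ X ∈ gJ g J s, X ∈ LieAlgebra.center ℝ g := by
  have hZ : ∀ X ∈ dcs g s, ∀ Y : g, ⁅X, Y⁆ = 0 := by
    intro X hX Y
    have h : ⁅Y, X⁆ ∈ dcs g (s + 1) := by
      unfold dcs at hX ⊢
      rw [LieModule.lowerCentralSeries_succ]
      exact LieSubmodule.lie_mem_lie (LieSubmodule.mem_top Y) hX
    rw [hstep, Submodule.mem_bot] at h
    rw [← lie_skew, h, neg_zero]
  have key : ∀ X : g, (∀ Y : g, ⁅X, Y⁆ = 0) → X ∈ LieAlgebra.center ℝ g := by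
    intro X h
    rw [LieModule.mem_maxTrivSubmodule]
    intro Y
    rw [← lie_skew, h, neg_zero]
  intro X hX
  obtain ⟨A, hA, B, hB, rfl⟩ := Submodule.mem_sup.1 hX
  obtain ⟨C, hC, rfl⟩ := hB
  apply key
  intro Y
  rw [add_lie, hZ A hA, ← habelian (J C) Y, hJ2, neg_lie, hZ C hC]
  simp
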